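/- arXiv:2402.11049 — 2 statements merged into one kernel-verified Lean document; each statement's English description precedes it below -/
import Mathlib

section
/- The set of pairs (A,B) ∈ GL₂(ℤ₂)² for which the smallest closed subgroup ⟨A,B⟩ of GL₂(ℤ₂) containing A and B has infinite index in GL₂(ℤ₂) has Haar measure zero. -/
open MeasureTheory

noncomputable instance : MeasurableSpace (GL (Fin 2) ℤ_[2]) := borel _

instance : BorelSpace (GL (Fin 2) ℤ_[2]) := ⟨rfl⟩

namespace HaarIndex

/-- The ring `ℤ₂`. -/
abbrev Z := ℤ_[2]
/-- The matrices. -/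
abbrev M := Matrix (Fin 2) (Fin 2) ℤ_[2]
/-- The group. -/
abbrev G := GL (Fin 2) ℤ_[2]

instance instCompactM : CompactSpace M :=
  inferInstanceAs (CompactSpace (Fin 2 → Fin 2 → ℤ_[2]))

instance instCompactG : CompactSpace G :=
  inferInstanceAs (CompactSpace Mˣ)

instance instSecM : SecondCountableTopology M :=
  inferInstanceAs (SecondCountableTopology (Fin 2 → Fin 2 → ℤ_[2]))

lemma isClosedEmbedding_val : Topology.IsClosedEmbedding (Units.val : G → M) :=
  Continuous.isClosedEmbedding Units.continuous_val Units.val_injective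

instance instSecG : SecondCountableTopology G :=
  isClosedEmbedding_val.isEmbedding.secondCountableTopology

instance instBorelP : BorelSpace (G × G) := Prod.borelSpace

/-- Matrices that are tangent directions of `H` at level `n`, with precision `e`. -/
def tang (H : Subgroup G) (e n : ℕ) : Set M :=
  {X | ∃ h ∈ H, ∃ E : M, (h : M) = 1 + (2 : Z) ^ n • (X + (2 : Z) ^ e • E)}

variable {H : Subgroup G} {e n : ℕ}

lemma tang_zero : (0 : M) ∈ tang H e n := ⟨1, H.one_mem, 0, by simp⟩

lemma tang_add_mul {X : M} (hX : X ∈ tang H e n) (E : M) : X + (2 : Z) ^ e • E ∈ tang H e n := by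
  obtain ⟨h, hh, F, hF⟩ := hX
  refine ⟨h, hh, F - E, ?_⟩
  rw [hF]; congr 2; rw [smul_sub]; abel

lemma tang_add (hen : e ≤ n) {X Y : M} (hX : X ∈ tang H e n) (hY : Y ∈ tang H e n) :
    X + Y ∈ tang H e n := by
  obtain ⟨h, hh, E, hE⟩ := hX
  obtain ⟨k, hk, F, hF⟩ := hY
  obtain ⟨r, rfl⟩ := Nat.exists_eq_add_of_le hen
  refine ⟨h * k, H.mul_mem hh hk,
    E + F + (2 : Z) ^ r • ((X + (2 : Z) ^ e • E) * (Y + (2 : Z) ^ e • F)), ?_⟩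
  rw [Units.val_mul, hE, hF]
  generalize hX' : X + (2 : Z) ^ e • E = X'
  generalize hY' : Y + (2 : Z) ^ e • F = Y'
  have : X + Y + (2 : Z) ^ e • (E + F + (2 : Z) ^ r • (X' * Y')) =
      X' + Y' + (2 : Z) ^ (e + r) • (X' * Y') := by
    rw [← hX', ← hY', pow_add]; module
  rw [this]
  simp only [mul_add, add_mul, one_mul, mul_one, smul_mul_assoc, mul_smul_comm, smul_add]
  abel

lemma tang_smul (hen : e ≤ n) (r : Z) {X : M} (hX : X ∈ tang H e n) : r • X ∈ tang H e n := by
  have hnat : ∀ m : ℕ, (m : Z) • X ∈ tang H e n := by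
    intro m
    induction m with
    | zero => simpa using tang_zero
    | succ m ih =>
      have := tang_add hen ih hX
      push_cast
      rwa [add_smul, one_smul]
  have h := PadicInt.appr_spec e r
  rw [Ideal.mem_span_singleton] at h
  obtain ⟨q, hq⟩ := h
  have h2 : r = (r.appr e : Z) + 2 ^ e * q := by
    push_cast at hq
    linear_combination hq
  rw [h2, add_smul, mul_smul]
  exact tang_add_mul (hnat _) _

/-- `tang` as a submodule. -/
def tangS (H : Subgroup G) (e n : ℕ) (hen : e ≤ n) : Submodule Z M where
  carrier := tang H e n
  add_mem' := tang_add hen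
  zero_mem' := tang_zero
  smul_mem' := fun r _ hX => tang_smul hen r hX

lemma tang_conj {g : G} (hg : g ∈ H) {X : M} (hX : X ∈ tang H e n) :
    (g : M) * X * ((g⁻¹ : G) : M) ∈ tang H e n := by
  obtain ⟨h, hh, E, hE⟩ := hX
  refine ⟨g * h * g⁻¹, H.mul_mem (H.mul_mem hg hh) (H.inv_mem hg),
    (g : M) * E * ((g⁻¹ : G) : M), ?_⟩
  rw [Units.val_mul, Units.val_mul, hE]
  simp only [mul_add, add_mul, mul_one, smul_mul_assoc, mul_smul_comm, smul_add, Units.mul_inv]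

lemma det_smul_inv (g : G) : (g : M).det • ((g⁻¹ : G) : M) = (g : M).adjugate := by
  have h := Matrix.mul_adjugate (g : M)
  have h2 : ((g⁻¹ : G) : M) * ((g : M) * (g : M).adjugate) = (g : M).adjugate := by
    rw [← mul_assoc, Units.inv_mul, one_mul]
  rw [← h2, h]; simp

lemma tang_adj (hen : e ≤ n) {g : G} (hg : g ∈ H) {X : M} (hX : X ∈ tang H e n) :
    (g : M) * X * (g : M).adjugate ∈ tang H e n := by
  rw [← det_smul_inv, mul_smul_comm]
  exact tang_smul hen _ (tang_conj hg hX)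

lemma tang_adj' (hen : e ≤ n) {g : G} (hg : g ∈ H) {X : M} (hX : X ∈ tang H e n) :
    (g : M).adjugate * X * (g : M) ∈ tang H e n := by
  rw [← det_smul_inv, smul_mul_assoc, smul_mul_assoc]
  have := tang_conj (H.inv_mem hg) hX
  rw [inv_inv] at this
  exact tang_smul hen _ this

lemma tang_succ (hen : e + 1 ≤ n) {X : M} (hX : X ∈ tang H e n) : X ∈ tang H e (n + 1) := by
  obtain ⟨h, hh, E, hE⟩ := hX
  obtain ⟨r, rfl⟩ := Nat.exists_eq_add_of_le hen
  refine ⟨h * h, H.mul_mem hh hh,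
    E + (2 : Z) ^ r • ((X + (2 : Z) ^ e • E) * (X + (2 : Z) ^ e • E)), ?_⟩
  rw [Units.val_mul, hE]
  generalize hX' : X + (2 : Z) ^ e • E = X'
  have : X + (2 : Z) ^ e • (E + (2 : Z) ^ r • (X' * X')) =
      X' + (2 : Z) ^ (e + r) • (X' * X') := by
    rw [← hX', pow_add]; module
  rw [this]
  simp only [mul_add, add_mul, one_mul, mul_one, smul_mul_assoc, mul_smul_comm]
  module

lemma tang_mono (hen : e + 1 ≤ n) {X : M} (hX : X ∈ tang H e n) (j : ℕ) :
    X ∈ tang H e (n + j) := by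
  induction j with
  | zero => exact hX
  | succ j ih => exact tang_succ (n := n + j) (by omega) ih

lemma approx {c : ℕ} (hn : c + 2 ≤ n) (hall : ∀ X : M, (2 : Z) ^ c • X ∈ tang H (c + 1) n)
    (Y : G) (E : M) (hY : (Y : M) = 1 + (2 : Z) ^ (n + c) • E) (j : ℕ) :
    ∃ h ∈ H, ∃ F : M, (Y : M) = (h : M) * (1 + (2 : Z) ^ (n + c + j) • F) := by
  induction j with
  | zero => exact ⟨1, H.one_mem, E, by simpa using hY⟩
  | succ j ih =>
    obtain ⟨h, hh, F, hF⟩ := ih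
    obtain ⟨k, hk, F', hF'⟩ := tang_mono (by omega) (hall F) j
    refine ⟨h * k, H.mul_mem hh hk, -(((k⁻¹ : G) : M) * F'), ?_⟩
    rw [hF, Units.val_mul, mul_assoc]
    congr 1
    rw [mul_add, mul_one, mul_smul_comm, mul_neg, ← mul_assoc, Units.mul_inv, one_mul, hF']
    rw [show n + c + (j + 1) = (n + j) + (c + 1) by ring, show n + c + j = (n + j) + c by ring]
    simp only [pow_add]
    module

lemma mem_closure_of_approx {c : ℕ} (hn : c + 2 ≤ n)
    (hall : ∀ X : M, (2 : Z) ^ c • X ∈ tang H (c + 1) n)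
    (Y : G) (E : M) (hY : (Y : M) = 1 + (2 : Z) ^ (n + c) • E) : Y ∈ H.topologicalClosure := by
  choose h hh F hF using approx hn hall Y E hY
  rw [← SetLike.mem_coe, Subgroup.topologicalClosure_coe,
    isClosedEmbedding_val.isInducing.closure_eq_preimage_closure_image]
  refine mem_closure_of_tendsto (f := fun j => ((h j : G) : M)) (b := Filter.atTop) ?_
    (Filter.Eventually.of_forall fun j => ⟨h j, hh j, rfl⟩)
  refine tendsto_pi_nhds.2 fun a => tendsto_pi_nhds.2 fun b => ?_
  rw [tendsto_iff_norm_sub_tendsto_zero]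
  refine squeeze_zero (fun _ => norm_nonneg _) (g := fun j : ℕ => (1 / 2 : ℝ) ^ j) (fun j => ?_)
    (tendsto_pow_atTop_nhds_zero_of_lt_one (by norm_num) (by norm_num))
  have h1 : (h j : M) a b - (Y : M) a b =
      (2 : Z) ^ j * (-(2 : Z) ^ (n + c) * ((h j : M) * F j) a b) := by
    have := congrFun (congrFun (hF j) a) b
    rw [mul_add, mul_one, mul_smul_comm] at this
    simp only [Matrix.add_apply, Matrix.smul_apply, smul_eq_mul] at this
    rw [pow_add] at this
    linear_combination -this
  rw [h1, norm_mul]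
  have h2 : ‖(2 : Z) ^ j‖ = (1 / 2 : ℝ) ^ j := by
    have := PadicInt.norm_p (p := 2)
    push_cast at this
    rw [norm_pow, this]; norm_num
  rw [h2]
  exact mul_le_of_le_one_right (by positivity) (PadicInt.norm_le_one _)

lemma index_ne_zero {c : ℕ} (hn : c + 2 ≤ n)
    (hall : ∀ X : M, (2 : Z) ^ c • X ∈ tang H (c + 1) n) : H.topologicalClosure.index ≠ 0 := by
  let f : G →* GL (Fin 2) (ZMod (2 ^ (n + c))) :=
    Matrix.GeneralLinearGroup.map (PadicInt.toZModPow (n + c))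
  have hle : f.ker ≤ H.topologicalClosure := by
    intro Y hY
    have key : ∀ a b, ∃ q : Z, (Y : M) a b - (1 : M) a b = 2 ^ (n + c) * q := by
      intro a b
      have h1 : PadicInt.toZModPow (n + c) ((Y : M) a b - (1 : M) a b) = 0 := by
        have h2 := congrArg (fun g : GL (Fin 2) (ZMod (2 ^ (n + c))) =>
          (g : Matrix (Fin 2) (Fin 2) (ZMod (2 ^ (n + c)))) a b) (MonoidHom.mem_ker.1 hY)
        have h3 : PadicInt.toZModPow (n + c) ((Y : M) a b) =
          (1 : Matrix (Fin 2) (Fin 2) (ZMod (2 ^ (n + c)))) a b := h2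
        rw [map_sub, h3]
        by_cases hab : a = b
        · subst hab; simp
        · simp [Matrix.one_apply_ne hab]
      rw [← RingHom.mem_ker, PadicInt.ker_toZModPow, Ideal.mem_span_singleton] at h1
      obtain ⟨q, hq⟩ := h1
      exact ⟨q, by rw [hq]; push_cast; rfl⟩
    choose q hq using key
    refine mem_closure_of_approx hn hall Y (Matrix.of q) ?_
    ext a b
    have := hq a b
    simp only [Matrix.add_apply, Matrix.smul_apply, smul_eq_mul, Matrix.of_apply]
    linear_combination this
  have : NeZero (2 ^ (n + c)) := ⟨by positivity⟩
  have : f.ker.FiniteIndex := Subgroup.finiteIndex_ker f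
  exact (Subgroup.finiteIndex_of_le hle).index_ne_zero

lemma isUnit_one_add (x : Z) : IsUnit (1 + 2 * x) := by
  have h : (1 + 2 * x) + (-(2 * x)) = 1 := by ring
  rcases IsLocalRing.isUnit_or_isUnit_of_add_one h with h | h
  · exact h
  · exfalso
    have h2 : IsUnit (2 : Z) := isUnit_of_mul_isUnit_left ((IsUnit.neg_iff _).1 h)
    exact PadicInt.p_nonunit (p := 2) (by exact_mod_cast h2)

lemma sq_eq (X : M) : X * X = X.trace • X - X.det • (1 : M) := by
  ext i j
  fin_cases i <;> fin_cases j <;>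
    simp [Matrix.mul_apply, Fin.sum_univ_two, Matrix.trace_fin_two, Matrix.det_fin_two] <;> ring

lemma pow_form (U : G) (X0 : M) (hU : (U : M) = 1 + (4 : Z) • X0) (k : ℕ) :
    ∃ u s : Z, IsUnit u ∧
      ((U ^ (2 ^ k) : G) : M) = 1 + (2 : Z) ^ (k + 2) • (u • X0 + s • (1 : M)) := by
  induction k with
  | zero => exact ⟨1, 0, isUnit_one, by rw [pow_zero, pow_one, hU]; norm_num⟩
  | succ k ih =>
    obtain ⟨u, s, hu, h⟩ := ih
    generalize hX : u • X0 + s • (1 : M) = X at h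
    refine ⟨(1 + 2 * (2 ^ k * X.trace)) * u, s + 2 ^ (k + 1) * (X.trace * s - X.det),
      (isUnit_one_add _).mul hu, ?_⟩
    rw [pow_succ, pow_mul, pow_two, Units.val_mul, h]
    have h3 : (1 + (2 : Z) ^ (k + 2) • X) * (1 + (2 : Z) ^ (k + 2) • X) =
      1 + (2 : Z) ^ (k + 3) • (X + (2 : Z) ^ (k + 1) • (X * X)) := by
      simp only [mul_add, add_mul, one_mul, mul_one, smul_mul_assoc, mul_smul_comm]
      module
    rw [h3, sq_eq]
    generalize X.trace = t
    generalize X.det = d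
    rw [← hX]
    module

lemma det_form (d : Z) (k : ℕ) : ∃ w : Z, IsUnit w ∧
    (1 + 4 * d) ^ (2 ^ k) - 1 = 2 ^ k * w * (4 * d) := by
  induction k with
  | zero => exact ⟨1, isUnit_one, by simp⟩
  | succ k ih =>
    obtain ⟨w, hw, h⟩ := ih
    refine ⟨w * (1 + 2 * (2 ^ k * w * d)), hw.mul (isUnit_one_add _), ?_⟩
    have h2 : (1 + 4 * d) ^ (2 ^ k) = 1 + 2 ^ k * w * (4 * d) := by linear_combination h
    rw [pow_succ, pow_mul, h2]
    ring

/-- The commutator. -/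
noncomputable def com (X Y : M) : M := X * Y - Y * X

/-- Determinant of three traceless matrices. -/
noncomputable def vol (P Q R : M) : Z :=
  P 0 0 * (Q 0 1 * R 1 0 - Q 1 0 * R 0 1) - P 0 1 * (Q 0 0 * R 1 0 - Q 1 0 * R 0 0)
    + P 1 0 * (Q 0 0 * R 0 1 - Q 0 1 * R 0 0)

lemma cramer (P Q R W : M) (hP : P 1 1 = - P 0 0) (hQ : Q 1 1 = - Q 0 0) (hR : R 1 1 = - R 0 0)
    (hW : W 1 1 = - W 0 0) :
    vol P Q R • W = vol W Q R • P + vol P W R • Q + vol P Q W • R := by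
  ext i j
  fin_cases i <;> fin_cases j <;> simp [vol, hP, hQ, hR, hW] <;> ring

lemma com_trace (X Y : M) : com X Y 1 1 = - com X Y 0 0 := by
  simp [com, Matrix.mul_apply, Fin.sum_univ_two]; ring

lemma vol_com (X Y : M) : vol (com X Y) (com X (com X Y)) (com Y (com X Y)) =
    -4 * (com X Y).det ^ 2 := by
  simp only [vol, com, Matrix.sub_apply, Matrix.mul_apply, Fin.sum_univ_two, Matrix.det_fin_two]
  ring

lemma tang_com (hen : e ≤ n) {g : G} (hg : g ∈ H) {W X : M} (hW : (g : M) = 1 + (4 : Z) • W)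
    {u s : Z} (hu : IsUnit u) (hX : u • X + s • (1 : M) ∈ tang H e n) :
    (8 : Z) • com X W ∈ tangS H e n hen ∧ (16 : Z) • com W (com X W) ∈ tangS H e n hen := by
  have hX' : u • X + s • (1 : M) ∈ tangS H e n hen := hX
  have cancel : ∀ (v : Z) (A : M), IsUnit v → v • A ∈ tangS H e n hen →
      A ∈ tangS H e n hen := by
    intro v A hv hA
    obtain ⟨v, rfl⟩ := hv
    have := (tangS H e n hen).smul_mem ((v⁻¹ : Zˣ) : Z) hA
    rwa [smul_smul, Units.inv_mul, one_smul] at this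
  have a1 : (g : M) * X * (g : M).adjugate - (g : M).det • X ∈ tangS H e n hen := by
    apply cancel u _ hu
    have h1 : (g : M) * (u • X + s • (1 : M)) * (g : M).adjugate ∈ tangS H e n hen :=
      tang_adj hen hg hX
    have h2 := (tangS H e n hen).sub_mem h1 ((tangS H e n hen).smul_mem (g : M).det hX')
    convert h2 using 1
    simp only [mul_add, add_mul, mul_one, smul_mul_assoc, mul_smul_comm, Matrix.mul_adjugate]
    module
  have a2 : (g : M).adjugate * X * (g : M) - (g : M).det • X ∈ tangS H e n hen := by
    apply cancel u _ hu
    have h1 : (g : M).adjugate * (u • X + s • (1 : M)) * (g : M) ∈ tangS H e n hen :=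
      tang_adj' hen hg hX
    have h2 := (tangS H e n hen).sub_mem h1 ((tangS H e n hen).smul_mem (g : M).det hX')
    convert h2 using 1
    simp only [mul_add, add_mul, mul_one, smul_mul_assoc, mul_smul_comm, Matrix.adjugate_mul]
    module
  rw [hW] at a1 a2
  constructor
  · apply cancel (1 + 2 * W.trace) _ (isUnit_one_add _)
    convert (tangS H e n hen).sub_mem a2 a1 using 1
    ext i j
    fin_cases i <;> fin_cases j <;>
      simp [com, Matrix.mul_apply, Fin.sum_univ_two, Matrix.trace_fin_two, Matrix.det_fin_two,
        Matrix.adjugate_fin_two, Matrix.vecMul, dotProduct] <;> ring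
  · convert (tangS H e n hen).neg_mem ((tangS H e n hen).add_mem a2 a1) using 1
    ext i j
    fin_cases i <;> fin_cases j <;>
      simp [com, Matrix.mul_apply, Fin.sum_univ_two, Matrix.det_fin_two,
        Matrix.adjugate_fin_two, Matrix.vecMul, dotProduct] <;> ring

lemma exists_dvd_pow {D : Z} (hD : D ≠ 0) : ∃ c : ℕ, D ∣ 2 ^ c := by
  refine ⟨D.valuation, ((PadicInt.unitCoeff hD)⁻¹ : Zˣ), ?_⟩
  have h := PadicInt.unitCoeff_spec hD
  push_cast at h
  nth_rewrite 2 [h]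
  rw [mul_comm _ ((2 : Z) ^ _), mul_assoc, Units.mul_inv, mul_one]

lemma core {U V : G} (hU : U ∈ H) (hV : V ∈ H) {X Y : M} (hX : (U : M) = 1 + (4 : Z) • X)
    (hY : (V : M) = 1 + (4 : Z) • Y) (hC : (com X Y).det ≠ 0) (hdet : (U : M).det ≠ 1) :
    H.topologicalClosure.index ≠ 0 := by
  obtain ⟨d, hd⟩ : ∃ d : Z, (U : M).det = 1 + 4 * d := by
    refine ⟨X.trace + 4 * X.det, ?_⟩
    rw [hX]
    simp [Matrix.det_fin_two, Matrix.trace_fin_two]; ring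
  have hd0 : d ≠ 0 := by rintro rfl; exact hdet (by rw [hd]; ring)
  obtain ⟨c, hc⟩ := exists_dvd_pow (D := 16 * (-4 * (com X Y).det ^ 2) * (4 * d))
    (mul_ne_zero (mul_ne_zero (by norm_num) (mul_ne_zero (by norm_num) (pow_ne_zero _ hC)))
      (mul_ne_zero (by norm_num) hd0))
  have hen : c + 1 ≤ c + 2 := by omega
  apply index_ne_zero (c := c) (n := c + 2) le_rfl
  obtain ⟨u, s, hu, hu'⟩ := pow_form U X hX c
  obtain ⟨v, r, hv, hv'⟩ := pow_form V Y hY c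
  have hX1 : u • X + s • (1 : M) ∈ tang H (c + 1) (c + 2) :=
    ⟨U ^ 2 ^ c, H.pow_mem hU _, 0, by rw [hu']; simp⟩
  have hY1 : v • Y + r • (1 : M) ∈ tang H (c + 1) (c + 2) :=
    ⟨V ^ 2 ^ c, H.pow_mem hV _, 0, by rw [hv']; simp⟩
  obtain ⟨h1, h2⟩ := tang_com hen hV hY hu hX1
  obtain ⟨-, h3⟩ := tang_com hen hU hX hv hY1
  have h1' := (tangS H (c + 1) (c + 2) hen).smul_mem (2 : Z) h1
  have h3' : (16 : Z) • com X (com X Y) ∈ tangS H (c + 1) (c + 2) hen := by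
    have := (tangS H (c + 1) (c + 2) hen).neg_mem h3
    convert this using 1
    simp only [com]
    rw [← smul_neg]; congr 1
    noncomm_ring
  have h1'' : (16 : Z) • com X Y ∈ tangS H (c + 1) (c + 2) hen := by
    convert h1' using 1
    rw [smul_smul]; norm_num
  have hsl : ∀ W : M, W 1 1 = - W 0 0 →
      (16 * (-4 * (com X Y).det ^ 2)) • W ∈ tangS H (c + 1) (c + 2) hen := by
    intro W hW
    rw [← vol_com, mul_smul, cramer _ _ _ W (com_trace _ _) (com_trace _ _) (com_trace _ _) hW,
      smul_add, smul_add]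
    refine Submodule.add_mem _ (Submodule.add_mem _ ?_ ?_) ?_
    · rw [smul_comm]; exact Submodule.smul_mem _ _ h1''
    · rw [smul_comm]; exact Submodule.smul_mem _ _ h3'
    · rw [smul_comm]; exact Submodule.smul_mem _ _ h2
  generalize hX1d : u • X + s • (1 : M) = X1 at hX1 hu'
  have hX1S : X1 ∈ tangS H (c + 1) (c + 2) hen := hX1
  -- the trace
  obtain ⟨z, hz⟩ : ∃ z : Z, 4 * d = z * X1.trace := by
    obtain ⟨w, hw, hw'⟩ := det_form d c
    have hdt : (1 + 4 * d) ^ 2 ^ c = 1 + 2 ^ (c + 2) * X1.trace + 2 ^ (2 * c + 4) * X1.det := by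
      have := congrArg Matrix.det hu'
      rw [Units.val_pow_eq_pow_val, Matrix.det_pow, hd] at this
      rw [this]
      simp [Matrix.det_fin_two, Matrix.trace_fin_two]; ring
    obtain ⟨q, hq⟩ : 4 * d ∣ 2 ^ c := dvd_trans (dvd_mul_left _ _) hc
    have h4 : 4 * X1.trace = (w + 2 * (-8 * q * X1.det)) * (4 * d) := by
      have h5 : (2 : Z) ^ c * (4 * X1.trace) =
          2 ^ c * ((w + 2 * (-8 * q * X1.det)) * (4 * d)) := by
        rw [hdt] at hw'
        rw [pow_add, pow_add, pow_mul'] at hw'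
        linear_combination hw' - 16 * 2 ^ c * X1.det * hq
      exact mul_left_cancel₀ (pow_ne_zero _ (by norm_num)) h5
    have hunit : IsUnit (w + 2 * (-8 * q * X1.det)) := by
      obtain ⟨w, rfl⟩ := hw
      have : (w : Z) + 2 * (-8 * q * X1.det) =
          w * (1 + 2 * (((w⁻¹ : Zˣ) : Z) * (-8 * q * X1.det))) := by
        have := Units.mul_inv w
        linear_combination (- 2 * (-8 * q * X1.det)) * this
      rw [this]
      exact w.isUnit.mul (isUnit_one_add _)
    obtain ⟨w', hw''⟩ := hunit
    refine ⟨((w'⁻¹ : Zˣ) : Z) * 4, ?_⟩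
    rw [mul_assoc, h4, ← hw'', ← mul_assoc, Units.inv_mul, one_mul]
  intro W
  show _ ∈ tangS H (c + 1) (c + 2) hen
  obtain ⟨q, hq⟩ := hc
  have h5 := hsl (X1.trace • W - W.trace • X1) (by
    simp [Matrix.trace_fin_two]; ring)
  have h6 := Submodule.add_mem _ h5 (Submodule.smul_mem _
    ((16 * (-4 * (com X Y).det ^ 2)) * W.trace) hX1S)
  have h7 := Submodule.smul_mem _ (q * z) h6
  convert h7 using 1
  rw [hq, hz]
  module

/-- Coefficient of `A` in `A ^ 6`. -/
def a6 {R : Type*} [CommRing R] (t d : R) : R := t * (t ^ 2 - d) * (t ^ 2 - 3 * d)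
/-- Coefficient of `1` in `A ^ 6`. -/
def b6 {R : Type*} [CommRing R] (t d : R) : R := t ^ 2 * d ^ 2 - (t ^ 2 - d) ^ 2 * d
/-- Coefficient of `A` in `A ^ 12`. -/
def a12 {R : Type*} [CommRing R] (t d : R) : R := a6 t d * (a6 t d * t + 2 * b6 t d)
/-- Coefficient of `1` in `A ^ 12`. -/
def b12 {R : Type*} [CommRing R] (t d : R) : R := b6 t d ^ 2 - a6 t d ^ 2 * d

lemma sq_form (A : M) (a b : Z) : (a • A + b • (1 : M)) * (a • A + b • (1 : M)) =
    (a * (a * A.trace + 2 * b)) • A + (b ^ 2 - a ^ 2 * A.det) • (1 : M) := by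
  have : (a • A + b • (1 : M)) * (a • A + b • (1 : M)) =
      (a ^ 2) • (A * A) + (2 * a * b) • A + (b ^ 2) • (1 : M) := by
    simp only [mul_add, add_mul, one_mul, mul_one, smul_mul_assoc, mul_smul_comm]
    module
  rw [this, sq_eq]
  module

lemma pow12 (A : M) : A ^ 12 = a12 A.trace A.det • A + b12 A.trace A.det • (1 : M) := by
  have h3 : A ^ 3 = (A.trace ^ 2 - A.det) • A + (-(A.trace * A.det)) • (1 : M) := by
    rw [pow_succ, pow_two, sq_eq, sub_mul, smul_mul_assoc, sq_eq, smul_mul_assoc, one_mul]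
    module
  have h6 : A ^ 6 = a6 A.trace A.det • A + b6 A.trace A.det • (1 : M) := by
    rw [show 6 = 3 * 2 by norm_num, pow_mul, pow_two, h3, sq_form]
    unfold a6 b6
    congr 2 <;> ring
  rw [show 12 = 6 * 2 by norm_num, pow_mul, pow_two, h6, sq_form]
  rfl

lemma zmod4 : ∀ t d : ZMod (2 ^ 2), (∃ d', d * d' = 1) → a12 t d = 0 ∧ b12 t d = 1 := by
  unfold a12 b12 a6 b6
  decide

lemma pow12_mod (A : G) : ∃ X : M, ((A ^ 12 : G) : M) = 1 + (4 : Z) • X ∧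
    (4 : Z) • X = a12 (A : M).trace (A : M).det • (A : M)
      + (b12 (A : M).trace (A : M).det - 1) • (1 : M) := by
  let f : Z →+* ZMod (2 ^ 2) := PadicInt.toZModPow 2
  have hf : ∀ x, f x = 0 → ∃ y, x = 4 * y := by
    intro x hx
    have hx' : x ∈ RingHom.ker (PadicInt.toZModPow (p := 2) 2) := hx
    rw [PadicInt.ker_toZModPow, Ideal.mem_span_singleton] at hx'
    obtain ⟨q, hq⟩ := hx'
    exact ⟨q, by rw [hq]; norm_num⟩
  have hdet : ∃ d', f (A : M).det * d' = 1 := by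
    refine ⟨f ((A⁻¹ : G) : M).det, ?_⟩
    rw [← map_mul, ← Matrix.det_mul, Units.mul_inv, Matrix.det_one, map_one]
  have f2 : f 2 = 2 := map_ofNat f 2
  have f3 : f 3 = 3 := map_ofNat f 3
  obtain ⟨h1, h2⟩ := zmod4 (f (A : M).trace) _ hdet
  have ha : f (a12 (A : M).trace (A : M).det) = 0 := by
    rw [← h1]; simp [a12, a6, b6, f2, f3]
  have hb : f (b12 (A : M).trace (A : M).det - 1) = 0 := by
    rw [map_sub, map_one, sub_eq_zero, ← h2]; simp [b12, a6, b6, f3]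
  obtain ⟨x, hx⟩ := hf _ ha
  obtain ⟨y, hy⟩ := hf _ hb
  have h4 : (4 : Z) • (x • (A : M) + y • (1 : M)) = a12 (A : M).trace (A : M).det • (A : M)
      + (b12 (A : M).trace (A : M).det - 1) • (1 : M) := by
    rw [hx, hy]; module
  refine ⟨x • (A : M) + y • (1 : M), ?_, h4⟩
  rw [h4, Units.val_pow_eq_pow_val, pow12]
  module

lemma good_pair (A B : G) (hA : a12 (A : M).trace (A : M).det ≠ 0)
    (hB : a12 (B : M).trace (B : M).det ≠ 0) (hC : (com A B).det ≠ 0)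
    (hdet : (A : M).det ^ 12 ≠ 1) :
    (Subgroup.closure {A, B} : Subgroup G).topologicalClosure.index ≠ 0 := by
  obtain ⟨X, hX, hX'⟩ := pow12_mod A
  obtain ⟨Y, hY, hY'⟩ := pow12_mod B
  refine core (U := A ^ 12) (V := B ^ 12)
    (Subgroup.pow_mem _ (Subgroup.subset_closure (by simp)) _)
    (Subgroup.pow_mem _ (Subgroup.subset_closure (by simp)) _) hX hY ?_ ?_
  · intro h0
    have h1 : com ((4 : Z) • X) ((4 : Z) • Y) = (16 : Z) • com X Y := by
      simp only [com, smul_mul_assoc, mul_smul_comm]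
      module
    have h2 : com ((4 : Z) • X) ((4 : Z) • Y) =
        (a12 (A : M).trace (A : M).det * a12 (B : M).trace (B : M).det) • com A B := by
      rw [hX', hY']
      simp only [com, mul_add, add_mul, one_mul, mul_one, smul_mul_assoc, mul_smul_comm]
      module
    have h3 := congrArg Matrix.det (h1.symm.trans h2)
    rw [Matrix.det_smul, Matrix.det_smul, h0, mul_zero] at h3
    exact mul_ne_zero (pow_ne_zero _ (mul_ne_zero hA hB)) hC h3.symm
  · rwa [Units.val_pow_eq_pow_val, Matrix.det_pow]

lemma null_of_finite (μ : Measure (G × G)) [IsFiniteMeasure μ] [μ.IsMulLeftInvariant]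
    (φ : ℕ → G × G) (E : Set (G × G)) (hE : MeasurableSet E)
    (h : ∀ᵐ p ∂μ, {s | φ s * p ∈ E}.Finite) : μ E = 0 := by
  let S : ℕ → Set (G × G) := fun N => ⋃ s ≥ N, (fun p => φ s * p) ⁻¹' E
  have hS : ∀ N, MeasurableSet (S N) := fun N =>
    MeasurableSet.biUnion (Set.to_countable _) fun s _ => measurable_const_mul (φ s) hE
  have hanti : Antitone S := by
    intro a b hab p hp
    simp only [S, Set.mem_iUnion] at hp ⊢
    obtain ⟨s, hs, hp⟩ := hp
    exact ⟨s, le_trans hab hs, hp⟩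
  have ht := tendsto_measure_iInter_atTop (μ := μ) (fun N => (hS N).nullMeasurableSet) hanti
    ⟨0, measure_ne_top _ _⟩
  have h0 : μ (⋂ N, S N) = 0 := by
    refine measure_mono_null ?_ (ae_iff.1 h)
    intro p hp hfin
    obtain ⟨N, hN⟩ := hfin.bddAbove
    have := Set.mem_iInter.1 hp (N + 1)
    simp only [S, Set.mem_iUnion] at this
    obtain ⟨s, hs, hp⟩ := this
    have h1 : s ≤ N := hN hp
    have h2 : N + 1 ≤ s := hs
    omega
  rw [h0] at ht
  refine le_antisymm (ge_of_tendsto' ht fun N => ?_) zero_le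
  calc μ E = μ ((fun p => φ N * p) ⁻¹' E) := (measure_preimage_mul μ _ _).symm
    _ ≤ μ (S N) := measure_mono (Set.subset_biUnion_of_mem (u := fun s => (fun p => φ s * p) ⁻¹' E)
        (show N ∈ {s | s ≥ N} from le_refl N))

lemma ae_ne (μ : Measure (G × G)) [IsFiniteMeasure μ] [μ.IsMulLeftInvariant]
    (φ : ℕ → G × G) (F : G × G → Z) (hF : Continuous F)
    (h : ∀ᵐ p ∂μ, {s | F (φ s * p) = 0}.Finite) : ∀ᵐ p ∂μ, F p ≠ 0 := by
  rw [ae_iff]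
  simp only [ne_eq, not_not]
  exact null_of_finite μ φ {p | F p = 0} (isClosed_eq hF continuous_const).measurableSet h

lemma finite_roots (p : Polynomial Z) (hp : p ≠ 0) (a b : Z) (hb : b ≠ 0) :
    {s : ℕ | p.eval (a + s * b) = 0}.Finite := by
  have h : {x : Z | p.IsRoot x}.Finite := p.finite_setOfPred_isRoot hp
  refine h.preimage (f := fun s : ℕ => a + s * b) ?_
  intro s _ s' _ hss
  have : (s : Z) * b = s' * b := add_left_cancel hss
  exact_mod_cast mul_right_cancel₀ hb this

lemma finite_lin (a b : Z) (hb : a ≠ 0 ∨ b ≠ 0) : {s : ℕ | a + s * b = 0}.Finite := by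
  by_cases h : b = 0
  · subst h
    have : {s : ℕ | a + s * 0 = 0} = ∅ := by
      ext s; simpa using hb
    rw [this]; exact Set.finite_empty
  · have := finite_roots Polynomial.X Polynomial.X_ne_zero a b h
    simpa using this

lemma finite_quad (a b c : Z) (hc : c ≠ 0) :
    {s : ℕ | a + s * b + s ^ 2 * c = 0}.Finite := by
  have hp : (Polynomial.C c * Polynomial.X ^ 2 + Polynomial.C b * Polynomial.X +
      Polynomial.C a) ≠ 0 := by
    intro h
    have := congrArg (fun p => Polynomial.coeff p 2) h
    simp at this
    exact hc this
  have := finite_roots _ hp 0 1 one_ne_zero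
  refine this.subset fun s hs => ?_
  simp only [Set.mem_ofPred_eq] at hs ⊢
  simp
  linear_combination hs

lemma finite_a12 (d t b : Z) (hb : b ≠ 0) : {s : ℕ | a12 (t + s * b) d = 0}.Finite := by
  let D : Polynomial Z := Polynomial.C d
  have hp : a12 (Polynomial.X : Polynomial Z) D ≠ 0 := by
    have h1 : a12 (Polynomial.X : Polynomial Z) D = Polynomial.X ^ 11 +
      (- Polynomial.C (10 * d) * Polynomial.X ^ 9 + Polynomial.C (36 * d ^ 2) * Polynomial.X ^ 7
        - Polynomial.C (56 * d ^ 3) * Polynomial.X ^ 5 + Polynomial.C (35 * d ^ 4) * Polynomial.X ^ 3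
        - Polynomial.C (6 * d ^ 5) * Polynomial.X) := by
      simp only [a12, a6, b6, D, map_mul, map_pow, map_ofNat]
      ring
    rw [h1]
    apply Polynomial.Monic.ne_zero
    apply Polynomial.monic_X_pow_add
    have : (- Polynomial.C (10 * d) * Polynomial.X ^ 9 + Polynomial.C (36 * d ^ 2) * Polynomial.X ^ 7
        - Polynomial.C (56 * d ^ 3) * Polynomial.X ^ 5 + Polynomial.C (35 * d ^ 4) * Polynomial.X ^ 3
        - Polynomial.C (6 * d ^ 5) * Polynomial.X : Polynomial Z).degree ≤ 9 := by
      compute_degree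
    exact lt_of_le_of_lt this (by norm_num)
  have := finite_roots _ hp t b hb
  simpa [a12, a6, b6, D] using this

/-- Upper unipotent. -/
noncomputable def up (s : Z) : G :=
  ⟨!![1, s; 0, 1], !![1, -s; 0, 1], by simp [Matrix.one_fin_two], by simp [Matrix.one_fin_two]⟩
/-- Lower unipotent. -/
noncomputable def lo (s : Z) : G :=
  ⟨!![1, 0; s, 1], !![1, 0; -s, 1], by simp [Matrix.one_fin_two], by simp [Matrix.one_fin_two]⟩
/-- A diagonal matrix. -/
noncomputable def dg (u : Zˣ) : G :=
  ⟨!![(u : Z), 0; 0, 1], !![((u⁻¹ : Zˣ) : Z), 0; 0, 1], by simp [Matrix.one_fin_two],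
    by simp [Matrix.one_fin_two]⟩

lemma up_mul (s : Z) (A : G) : ((up s * A : G) : M) =
    !![(A : M) 0 0 + s * (A : M) 1 0, (A : M) 0 1 + s * (A : M) 1 1; (A : M) 1 0, (A : M) 1 1] := by
  rw [Units.val_mul]
  ext i j
  fin_cases i <;> fin_cases j <;> simp [up, Matrix.mul_apply, Fin.sum_univ_two]

lemma lo_mul (s : Z) (A : G) : ((lo s * A : G) : M) =
    !![(A : M) 0 0, (A : M) 0 1; (A : M) 1 0 + s * (A : M) 0 0, (A : M) 1 1 + s * (A : M) 0 1] := by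
  rw [Units.val_mul]
  ext i j
  fin_cases i <;> fin_cases j <;> simp [lo, Matrix.mul_apply, Fin.sum_univ_two, add_comm]

lemma cont_fst (i j : Fin 2) : Continuous fun p : G × G => (p.1 : M) i j :=
  (Units.continuous_val.comp continuous_fst).matrix_elem i j

lemma cont_snd (i j : Fin 2) : Continuous fun p : G × G => (p.2 : M) i j :=
  (Units.continuous_val.comp continuous_snd).matrix_elem i j

lemma det_ne (A : G) : (A : M) 0 0 * (A : M) 1 1 - (A : M) 0 1 * (A : M) 1 0 ≠ 0 := by
  rw [← Matrix.det_fin_two]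
  exact ((Matrix.isUnit_iff_isUnit_det _).1 A.isUnit).ne_zero

lemma ae_good (μ : Measure (G × G)) [IsFiniteMeasure μ] [μ.IsMulLeftInvariant] :
    ∀ᵐ p ∂μ, (a12 (p.1 : M).trace (p.1 : M).det ≠ 0 ∧ a12 (p.2 : M).trace (p.2 : M).det ≠ 0) ∧
      (com p.1 p.2).det ≠ 0 ∧ (p.1 : M).det ^ 12 ≠ 1 := by
  have c1 := cont_fst
  have c2 := cont_snd
  have ca : ∀ A : G, (A : M) 1 0 ≠ 0 ∨ (A : M) 0 0 ≠ 0 := by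
    intro A
    by_contra! h
    exact det_ne A (by rw [h.1, h.2]; ring)
  have n1 : ∀ᵐ p ∂μ, (p.1 : M) 1 0 ≠ 0 := by
    refine ae_ne μ (fun s => (lo s, 1)) (fun p => (p.1 : M) 1 0) (c1 1 0) (ae_of_all _ fun p => ?_)
    refine (finite_lin _ _ (ca p.1)).subset fun s hs => ?_
    simp only [Set.mem_ofPred_eq, Prod.fst_mul, lo_mul] at hs ⊢
    simpa using hs
  have n1' : ∀ᵐ p ∂μ, (p.2 : M) 1 0 ≠ 0 := by
    refine ae_ne μ (fun s => (1, lo s)) (fun p => (p.2 : M) 1 0) (c2 1 0) (ae_of_all _ fun p => ?_)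
    refine (finite_lin _ _ (ca p.2)).subset fun s hs => ?_
    simp only [Set.mem_ofPred_eq, Prod.snd_mul, lo_mul] at hs ⊢
    simpa using hs
  have n2 : ∀ᵐ p ∂μ, a12 (p.1 : M).trace (p.1 : M).det ≠ 0 := by
    refine ae_ne μ (fun s => (up s, 1)) (fun p => a12 (p.1 : M).trace (p.1 : M).det) ?_ ?_
    · simp only [a12, a6, b6, Matrix.trace_fin_two, Matrix.det_fin_two]
      fun_prop
    · filter_upwards [n1] with p hp
      refine (finite_a12 (p.1 : M).det (p.1 : M).trace _ hp).subset fun s hs => ?_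
      simp only [Set.mem_ofPred_eq, Prod.fst_mul, up_mul] at hs ⊢
      rw [← hs]
      congr 1
      · simp [Matrix.trace_fin_two]; ring
      · simp [Matrix.det_fin_two]; ring
  have n2' : ∀ᵐ p ∂μ, a12 (p.2 : M).trace (p.2 : M).det ≠ 0 := by
    refine ae_ne μ (fun s => (1, up s)) (fun p => a12 (p.2 : M).trace (p.2 : M).det) ?_ ?_
    · simp only [a12, a6, b6, Matrix.trace_fin_two, Matrix.det_fin_two]
      fun_prop
    · filter_upwards [n1'] with p hp
      refine (finite_a12 (p.2 : M).det (p.2 : M).trace _ hp).subset fun s hs => ?_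
      simp only [Set.mem_ofPred_eq, Prod.snd_mul, up_mul] at hs ⊢
      rw [← hs]
      congr 1
      · simp [Matrix.trace_fin_two]; ring
      · simp [Matrix.det_fin_two]; ring
  have n3 : ∀ᵐ p ∂μ, (p.1 : M).det ^ 12 - 1 ≠ 0 := by
    obtain ⟨u, hu⟩ := isUnit_one_add 1
    refine ae_ne μ (fun s => (dg (u ^ s), 1)) (fun p => (p.1 : M).det ^ 12 - 1) ?_
      (ae_of_all _ fun p => ?_)
    · simp only [Matrix.det_fin_two]
      fun_prop
    · apply Set.Subsingleton.finite
      intro s hs s' hs'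
      have hform : ∀ r : ℕ, (((dg (u ^ r) * p.1 : G)) : M).det = 3 ^ r * (p.1 : M).det := by
        intro r
        rw [Units.val_mul, Matrix.det_mul]
        congr 1
        simp [dg, Matrix.det_fin_two, hu]
        norm_num
      simp only [Set.mem_ofPred_eq, Prod.fst_mul, hform] at hs hs'
      have hd : (p.1 : M).det ≠ 0 := ((Matrix.isUnit_iff_isUnit_det _).1 p.1.isUnit).ne_zero
      have h1 : ((3 : Z) ^ s) ^ 12 = (3 ^ s') ^ 12 := by
        apply mul_right_cancel₀ (pow_ne_zero 12 hd)
        linear_combination hs - hs'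
      have h2 : (3 ^ s) ^ 12 = (3 ^ s') ^ 12 := by exact_mod_cast h1
      exact Nat.pow_right_injective (show 2 ≤ 3 by norm_num) (Nat.pow_left_injective (by norm_num) h2)
  have n4 : ∀ᵐ p ∂μ, (p.1 : M) 1 0 * (p.2 : M) 1 1 - (p.1 : M) 1 1 * (p.2 : M) 1 0 ≠ 0 := by
    refine ae_ne μ (fun s => (lo s, 1))
      (fun p => (p.1 : M) 1 0 * (p.2 : M) 1 1 - (p.1 : M) 1 1 * (p.2 : M) 1 0) (by fun_prop) ?_
    filter_upwards [n1'] with p hp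
    refine (finite_lin ((p.1 : M) 1 0 * (p.2 : M) 1 1 - (p.1 : M) 1 1 * (p.2 : M) 1 0)
      ((p.1 : M) 0 0 * (p.2 : M) 1 1 - (p.1 : M) 0 1 * (p.2 : M) 1 0) ?_).subset fun s hs => ?_
    · by_contra! h
      refine mul_ne_zero (det_ne p.1) hp ?_
      linear_combination (p.1 : M) 1 0 * h.2 - (p.1 : M) 0 0 * h.1
    · simp only [Set.mem_ofPred_eq, Prod.fst_mul, Prod.snd_mul, lo_mul, one_mul] at hs ⊢
      simp at hs
      linear_combination hs
  have n5 : ∀ᵐ p ∂μ, (p.1 : M) 1 0 * (p.2 : M) 1 1 ^ 2 +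
      ((p.1 : M) 0 0 - (p.1 : M) 1 1) * (p.2 : M) 1 0 * (p.2 : M) 1 1
        - (p.1 : M) 0 1 * (p.2 : M) 1 0 ^ 2 ≠ 0 := by
    refine ae_ne μ (fun s => (up s, 1)) (fun p => (p.1 : M) 1 0 * (p.2 : M) 1 1 ^ 2 +
      ((p.1 : M) 0 0 - (p.1 : M) 1 1) * (p.2 : M) 1 0 * (p.2 : M) 1 1
        - (p.1 : M) 0 1 * (p.2 : M) 1 0 ^ 2) (by fun_prop) ?_
    filter_upwards [n1', n4] with p hp hp'
    refine (finite_lin ((p.1 : M) 1 0 * (p.2 : M) 1 1 ^ 2 +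
      ((p.1 : M) 0 0 - (p.1 : M) 1 1) * (p.2 : M) 1 0 * (p.2 : M) 1 1
        - (p.1 : M) 0 1 * (p.2 : M) 1 0 ^ 2)
      ((p.2 : M) 1 0 * ((p.1 : M) 1 0 * (p.2 : M) 1 1 - (p.1 : M) 1 1 * (p.2 : M) 1 0))
      (Or.inr (mul_ne_zero hp hp'))).subset fun s hs => ?_
    simp only [Set.mem_ofPred_eq, Prod.fst_mul, Prod.snd_mul, up_mul, one_mul] at hs ⊢
    simp at hs
    linear_combination hs
  have n6 : ∀ᵐ p ∂μ, (com p.1 p.2).det ≠ 0 := by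
    refine ae_ne μ (fun s => (1, up s)) (fun p => (com p.1 p.2).det) ?_ ?_
    · simp only [com, Matrix.det_fin_two, Matrix.sub_apply, Matrix.mul_apply, Fin.sum_univ_two]
      fun_prop
    filter_upwards [n1, n5] with p hp hp'
    obtain ⟨A, B⟩ := p
    simp only at hp hp'
    refine (finite_quad (com A B).det
      (-2 * ((A : M) 0 1 * (B : M) 1 0 - (A : M) 1 0 * (B : M) 0 1) * (-(A : M) 1 0 * (B : M) 1 1)
        - (((A : M) 0 0 - (A : M) 1 1) * (B : M) 0 1 -
            (A : M) 0 1 * ((B : M) 0 0 - (B : M) 1 1)) * ((A : M) 1 0 * (B : M) 1 0)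
        - (((A : M) 0 0 - (A : M) 1 1) * (B : M) 1 1 - (A : M) 0 1 * (B : M) 1 0) *
          ((A : M) 1 0 * ((B : M) 0 0 - (B : M) 1 1) - ((A : M) 0 0 - (A : M) 1 1) * (B : M) 1 0))
      (-((A : M) 1 0) * ((A : M) 1 0 * (B : M) 1 1 ^ 2 +
        ((A : M) 0 0 - (A : M) 1 1) * (B : M) 1 0 * (B : M) 1 1
        - (A : M) 0 1 * (B : M) 1 0 ^ 2))
      (mul_ne_zero (neg_ne_zero.2 hp) hp')).subset fun s hs => ?_
    simp only [Set.mem_ofPred_eq, Prod.mk_mul_mk, one_mul, up_mul] at hs ⊢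
    rw [← hs]
    simp [com, Matrix.det_fin_two, Matrix.mul_apply, Fin.sum_univ_two, Matrix.vecMul, dotProduct]
    ring
  filter_upwards [n2, n2', n3, n6] with p h2 h2' h3 h6
  exact ⟨⟨h2, h2'⟩, h6, fun h => h3 (by rw [h]; ring)⟩

end HaarIndex

/-- The set of pairs `(A, B) ∈ GL₂(ℤ₂)²` for which the smallest closed subgroup `⟨A, B⟩` of
`GL₂(ℤ₂)` containing `A` and `B` has infinite index in `GL₂(ℤ₂)` has Haar measure zero. -/
theorem haar_measure_infinite_index_pairs_eq_zero
    (μ : Measure (GL (Fin 2) ℤ_[2] × GL (Fin 2) ℤ_[2])) [μ.IsHaarMeasure] :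
    μ {AB : GL (Fin 2) ℤ_[2] × GL (Fin 2) ℤ_[2] |
        (Subgroup.closure {AB.1, AB.2} : Subgroup (GL (Fin 2) ℤ_[2])).topologicalClosure.index
          = 0} = 0 := by
  have hfin : IsFiniteMeasure μ := CompactSpace.isFiniteMeasure
  refine measure_mono_null ?_ (ae_iff.1 (HaarIndex.ae_good μ))
  intro p hp hgood
  exact HaarIndex.good_pair p.1 p.2 hgood.1.1 hgood.1.2 hgood.2.1 hgood.2.2 hp
end

section
/- Let p be a prime, n a positive integer, and let f(x₁,…,xₙ) = Σ_{s ∈ ℤ_{≥0}ⁿ} a_s x^s be a multivariable power series with coefficients a_s ∈ ℚ_p, not all zero, which converges (the defining series is summable) at every point of an open subset D ⊆ ℤ_pⁿ. Then the set {(x₁,…,xₙ) ∈ D : f(x₁,…,xₙ) = 0} has measure zero with respect to the Haar measure on ℤ_pⁿ. -/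
open MeasureTheory

noncomputable instance (p : ℕ) [Fact p.Prime] : MeasurableSpace ℤ_[p] := borel _

instance (p : ℕ) [Fact p.Prime] : BorelSpace ℤ_[p] := ⟨rfl⟩

open Filter Topology

theorem padic_summable_mul {p : ℕ} [Fact p.Prime] {ι : Type*} {b u : ι → ℚ_[p]}
    (hb : Summable b) (hu : ∀ i, ‖u i‖ ≤ 1) : Summable fun i => b i * u i := by
  apply NonarchimedeanAddGroup.summable_of_tendsto_cofinite_zero
  have h := hb.tendsto_cofinite_zero
  refine squeeze_zero_norm (a := fun i => ‖b i‖) (fun i => ?_) ?_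
  · rw [norm_mul]
    exact mul_le_of_le_one_right (norm_nonneg _) (hu i)
  · simpa using h.norm

theorem padic_norm_tsum_lt {p : ℕ} [Fact p.Prime] {ι : Type*} {c : ι → ℚ_[p]}
    (hc : Summable c) {A : ℝ} (hA : 0 < A) (h : ∀ i, ‖c i‖ < A) : ‖∑' i, c i‖ < A := by
  have h1 : ∀ s : Finset ι, ‖∑ i ∈ s, c i‖ < A := by
    intro s
    classical
    induction s using Finset.induction_on with
    | empty => simpa using hA
    | insert i s hi ih =>
      rw [Finset.sum_insert hi]
      exact (IsUltrametricDist.norm_add_le_max _ _).trans_lt (max_lt (h i) ih)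
  have h2 := (Metric.tendsto_nhds.1 hc.hasSum A hA).exists
  obtain ⟨s, hs⟩ := h2
  rw [dist_comm, dist_eq_norm] at hs
  have : ∑' i, c i = (∑' i, c i - ∑ i ∈ s, c i) + ∑ i ∈ s, c i := by ring
  rw [this]
  exact (IsUltrametricDist.norm_add_le_max _ _).trans_lt (max_lt hs (h1 s))

theorem padic_strassmann_aux {p : ℕ} [Fact p.Prime] (N : ℕ) : ∀ (a : ℕ → ℚ_[p]),
    Summable a → a N ≠ 0 → (∀ k, ‖a k‖ ≤ ‖a N‖) → (∀ k, N < k → ‖a k‖ < ‖a N‖) →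
    {x : ℚ_[p] | ‖x‖ ≤ 1 ∧ ∑' k, a k * x ^ k = 0}.Finite := by
  induction N with
  | zero =>
    intro a ha h0 _ hlt
    convert Set.finite_empty
    ext x
    simp only [Set.mem_ofPred_eq, Set.mem_empty_iff_false, iff_false, not_and]
    intro hx hz
    have hs : Summable fun k => a k * x ^ k :=
      padic_summable_mul ha (fun k => by rw [norm_pow]; exact pow_le_one₀ (norm_nonneg _) hx)
    rw [hs.tsum_eq_zero_add] at hz
    have h1 : ‖∑' k, a (k + 1) * x ^ (k + 1)‖ < ‖a 0‖ := by
      apply padic_norm_tsum_lt ((summable_nat_add_iff 1).2 hs) (norm_pos_iff.2 h0)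
      intro k
      rw [norm_mul, norm_pow]
      exact (mul_le_of_le_one_right (norm_nonneg _) (pow_le_one₀ (norm_nonneg _) hx)).trans_lt
        (hlt _ (Nat.succ_pos k))
    have h2 : a 0 = - ∑' k, a (k + 1) * x ^ (k + 1) := by
      rw [pow_zero, mul_one] at hz
      exact eq_neg_of_add_eq_zero_left hz
    rw [← norm_neg, ← h2] at h1
    exact lt_irrefl _ h1
  | succ N ih =>
    intro a ha h0 hle hlt
    have hs : ∀ x : ℚ_[p], ‖x‖ ≤ 1 → ∀ b : ℕ → ℚ_[p], Summable b →
        Summable fun k => b k * x ^ k := fun x hx b hb =>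
      padic_summable_mul hb (fun k => by rw [norm_pow]; exact pow_le_one₀ (norm_nonneg _) hx)
    by_cases hex : ∃ α : ℚ_[p], ‖α‖ ≤ 1 ∧ ∑' k, a k * α ^ k = 0
    swap
    · convert Set.finite_empty
      ext x
      simp only [Set.mem_ofPred_eq, Set.mem_empty_iff_false, iff_false]
      exact fun h => hex ⟨x, h⟩
    obtain ⟨α, hα, hz⟩ := hex
    have hsh : ∀ j, Summable fun k => a (k + j) := fun j => (summable_nat_add_iff j).2 ha
    set t : ℕ → ℚ_[p] := fun j => ∑' k, a (k + j) * α ^ k with ht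
    have ht0 : t 0 = 0 := hz
    have hrec : ∀ j, t j = a j + α * t (j + 1) := by
      intro j
      simp only [ht]
      rw [(hs α hα _ (hsh j)).tsum_eq_zero_add, ← tsum_mul_left]
      simp only [zero_add, pow_zero, mul_one]
      congr 1
      apply tsum_congr
      intro k
      rw [show k + 1 + j = k + (j + 1) by ring]
      ring
    have hterm : ∀ j k, ‖a (k + j) * α ^ k‖ ≤ ‖a (k + j)‖ := by
      intro j k
      rw [norm_mul, norm_pow]
      exact mul_le_of_le_one_right (norm_nonneg _) (pow_le_one₀ (norm_nonneg _) hα)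
    have htle : ∀ j (C : ℝ), (∀ k, ‖a (k + j)‖ ≤ C) → ‖t j‖ ≤ C := by
      intro j C hC
      exact IsUltrametricDist.norm_tsum_le_of_forall_le fun k => (hterm j k).trans (hC k)
    have htlt : ∀ j, N + 1 < j → ‖t j‖ < ‖a (N + 1)‖ := by
      intro j hj
      apply padic_norm_tsum_lt (hs α hα _ (hsh j)) (norm_pos_iff.2 h0)
      exact fun k => (hterm j k).trans_lt (hlt _ (by omega))
    have htN : ‖t (N + 1)‖ = ‖a (N + 1)‖ := by
      rw [hrec]
      have h3 : ‖α * t (N + 1 + 1)‖ < ‖a (N + 1)‖ := by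
        rw [norm_mul]
        exact (mul_le_of_le_one_left (norm_nonneg _) hα).trans_lt (htlt _ (by omega))
      rw [IsUltrametricDist.norm_add_eq_max_of_norm_ne_norm h3.ne', max_eq_left h3.le]
    have htsum : Summable fun j => t (j + 1) := by
      apply NonarchimedeanAddGroup.summable_of_tendsto_cofinite_zero
      rw [Nat.cofinite_eq_atTop]
      have ha0 := ha.tendsto_cofinite_zero
      rw [Nat.cofinite_eq_atTop, Metric.tendsto_atTop] at ha0
      rw [Metric.tendsto_atTop]
      intro ε hε
      obtain ⟨M, hM⟩ := ha0 (ε / 2) (half_pos hε)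
      refine ⟨M, fun j hj => ?_⟩
      rw [dist_zero_right]
      refine (htle (j + 1) (ε / 2) fun k => ?_).trans_lt (half_lt_self hε)
      have := hM (k + (j + 1)) (by omega)
      rw [dist_zero_right] at this
      exact this.le
    have key := ih (fun j => t (j + 1)) htsum (by
        intro h
        rw [h, norm_zero] at htN
        exact h0 (norm_eq_zero.1 htN.symm))
      (fun k => by rw [htN]; exact htle _ _ fun _ => hle _)
      (fun k hk => by rw [htN]; exact htlt _ (by omega))
    refine (key.insert α).subset ?_
    rintro x ⟨hx, hxz⟩
    by_cases hxα : x = α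
    · exact Or.inl hxα
    right
    refine ⟨hx, ?_⟩
    have hst := hs x hx _ htsum
    have hst' : Summable fun j => t j * x ^ j := by
      rw [← summable_nat_add_iff 1]
      refine (hst.mul_right x).congr fun k => ?_
      ring
    have e1 : ∑' k, t k * x ^ k = (∑' k, t (k + 1) * x ^ k) * x := by
      rw [hst'.tsum_eq_zero_add, ht0, zero_mul, zero_add, ← tsum_mul_right]
      exact tsum_congr fun k => by ring
    have e2 : ∑' k, t k * x ^ k = ∑' k, a k * x ^ k + α * ∑' k, t (k + 1) * x ^ k := by
      rw [← tsum_mul_left, ← (hs x hx _ ha).tsum_add (hst.mul_left α)]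
      exact tsum_congr fun k => by rw [hrec k]; ring
    rw [hxz, zero_add, e1] at e2
    have e3 : (x - α) * ∑' k, t (k + 1) * x ^ k = 0 := by linear_combination e2
    exact (mul_eq_zero.1 e3).resolve_left (sub_ne_zero.2 hxα)

theorem padic_strassmann {p : ℕ} [Fact p.Prime] (a : ℕ → ℚ_[p])
    (ha : Summable a) (h0 : ∃ k, a k ≠ 0) :
    {x : ℚ_[p] | ‖x‖ ≤ 1 ∧ ∑' k, a k * x ^ k = 0}.Finite := by
  obtain ⟨k0, hk0⟩ := h0
  have hfin : ∀ k1, a k1 ≠ 0 → {k | ‖a k1‖ ≤ ‖a k‖}.Finite := by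
    intro k1 hk1
    have h := ha.tendsto_cofinite_zero.norm
    rw [norm_zero] at h
    have := h.eventually (gt_mem_nhds (norm_pos_iff.2 hk1))
    simpa [Filter.eventually_cofinite] using this
  obtain ⟨k1, hk1, hmax⟩ := Set.exists_max_image _ (fun k => ‖a k‖) (hfin k0 hk0) ⟨k0, le_refl ‖a k0‖⟩
  have hall : ∀ k, ‖a k‖ ≤ ‖a k1‖ := by
    intro k
    by_cases h : ‖a k0‖ ≤ ‖a k‖
    · exact hmax k h
    · exact (not_le.1 h).le.trans hk1
  have hk1' : a k1 ≠ 0 := norm_pos_iff.1 ((norm_pos_iff.2 hk0).trans_le hk1)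
  obtain ⟨N, hN, hNmax⟩ := Set.exists_max_image _ (fun k => k) (hfin k1 hk1') ⟨k1, le_refl ‖a k1‖⟩
  refine padic_strassmann_aux N a ha (norm_pos_iff.1 ((norm_pos_iff.2 hk1').trans_le hN))
    (fun k => (hall k).trans hN) (fun k hk => ?_)
  by_contra hcon
  exact absurd (hNmax k (le_trans hN (not_lt.1 hcon))) (not_le.2 hk)

theorem padic_null_aux {p : ℕ} [Fact p.Prime] [MeasurableSpace ℚ_[p]] [BorelSpace ℚ_[p]] (n : ℕ) :
    ∀ (a : (Fin n → ℕ) → ℚ_[p]), Summable a → (∃ s, a s ≠ 0) →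
    ∀ (ν : Fin n → Measure ℤ_[p]) [∀ i, SigmaFinite (ν i)] (φ : Fin n → ℤ_[p] → ℚ_[p]),
    (∀ i, Measurable (φ i)) → (∀ i x, ‖φ i x‖ ≤ 1) → (∀ i y, ν i (φ i ⁻¹' {y}) = 0) →
    Measure.pi ν {x | ∑' s : Fin n → ℕ, a s * ∏ i, φ i (x i) ^ s i = 0} = 0 := by
  induction n with
  | zero =>
    rintro a ha ⟨s, hs⟩ ν _ φ _ _ _
    convert measure_empty (μ := Measure.pi ν)
    ext x
    simp only [Set.mem_ofPred_eq, Set.mem_empty_iff_false, iff_false]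
    rw [tsum_eq_single s (fun t ht => absurd (Subsingleton.elim t s) ht)]
    simpa using hs
  | succ n ih =>
    rintro a ha ⟨s, hs⟩ ν _ φ hφm hφ hφν
    have hone : ∀ (m : ℕ) (ψ : Fin m → ℤ_[p] → ℚ_[p]), (∀ i x, ‖ψ i x‖ ≤ 1) →
        ∀ (x : Fin m → ℤ_[p]) (s : Fin m → ℕ), ‖∏ i, ψ i (x i) ^ s i‖ ≤ 1 := by
      intro m ψ hψ x s
      rw [norm_prod]
      refine Finset.prod_le_one (fun _ _ => norm_nonneg _) fun i _ => ?_
      rw [norm_pow]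
      exact pow_le_one₀ (norm_nonneg _) (hψ i _)
    have hsum : ∀ x : Fin (n + 1) → ℤ_[p],
        Summable fun s : Fin (n + 1) → ℕ => a s * ∏ i, φ i (x i) ^ s i := fun x =>
      padic_summable_mul ha (hone _ φ hφ x)
    have hmeas : MeasurableSet
        {x : Fin (n + 1) → ℤ_[p] | ∑' s : Fin (n + 1) → ℕ, a s * ∏ i, φ i (x i) ^ s i = 0} := by
      have hm : Measurable fun x : Fin (n + 1) → ℤ_[p] =>
          ∑' s : Fin (n + 1) → ℕ, a s * ∏ i, φ i (x i) ^ s i := by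
        refine measurable_of_tendsto_metrizable' (f := fun (t : Finset (Fin (n + 1) → ℕ)) x =>
          ∑ s ∈ t, a s * ∏ i, φ i (x i) ^ s i) atTop (fun t => ?_) ?_
        · refine Finset.measurable_sum _ fun s _ => ?_
          refine Measurable.const_mul (Finset.measurable_prod _ fun i _ => ?_) _
          exact ((hφm i).comp (measurable_pi_apply i)).pow_const _
        · rw [tendsto_pi_nhds]
          exact fun x => (hsum x).hasSum
      exact hm (measurableSet_singleton 0)
    have mp := measurePreserving_piFinSuccAbove ν 0
    rw [← mp.symm.measure_preimage_equiv]
    rw [Measure.measure_prod_null ((MeasurableEquiv.measurable _) hmeas)]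
    -- reindexing
    let e : (Fin n → ℕ) × ℕ ≃ (Fin (n + 1) → ℕ) :=
      (Equiv.prodComm _ _).trans (Fin.insertNthEquiv (fun _ => ℕ) 0)
    have he : ∀ q, e q = Fin.cons q.2 q.1 := by
      intro q
      simp [e, Fin.insertNthEquiv]
    have hae : Summable fun q : (Fin n → ℕ) × ℕ => a (e q) := e.summable_iff.2 ha
    let s' : Fin n → ℕ := (e.symm s).1
    have hst := padic_strassmann (fun k => a (e (s', k))) (hae.prod_factor s')
      ⟨(e.symm s).2, by
        have : e (s', (e.symm s).2) = s := e.apply_symm_apply s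
        rw [this]; exact hs⟩
    have hnull : ν 0 (φ 0 ⁻¹' {x : ℚ_[p] | ‖x‖ ≤ 1 ∧ ∑' k, a (e (s', k)) * x ^ k = 0}) = 0 := by
      rw [← Set.biUnion_preimage_singleton]
      exact (measure_biUnion_null_iff hst.countable).2 fun y _ => hφν 0 y
    rw [Filter.EventuallyEq, ae_iff]
    refine measure_mono_null ?_ hnull
    intro x0 hx0
    by_contra hcon
    apply hx0
    have hne : ∑' k, a (e (s', k)) * φ 0 x0 ^ k ≠ 0 := fun h => hcon ⟨hφ 0 x0, h⟩
    have hae' : Summable fun q : (Fin n → ℕ) × ℕ => a (e q) * φ 0 x0 ^ q.2 :=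
      padic_summable_mul hae fun q => by
        rw [norm_pow]; exact pow_le_one₀ (norm_nonneg _) (hφ 0 x0)
    have := ih (fun s => ∑' k, a (e (s, k)) * φ 0 x0 ^ k) hae'.prod ⟨s', hne⟩
      (fun j => ν (Fin.succAbove 0 j)) (fun j => φ (Fin.succAbove 0 j))
      (fun j => hφm _) (fun j => hφ _) (fun j => hφν _)
    refine measure_mono_null ?_ this
    intro x' hx'
    simp only [Set.mem_preimage, Set.mem_ofPred_eq] at hx' ⊢
    rw [← hx', ← e.tsum_eq]
    have hX : ∀ q : (Fin n → ℕ) × ℕ,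
        (∏ i, φ i ((MeasurableEquiv.piFinSuccAbove (fun _ => ℤ_[p]) 0).symm (x0, x') i) ^ e q i)
        = φ 0 x0 ^ q.2 * ∏ j : Fin n, φ (Fin.succAbove 0 j) (x' j) ^ q.1 j := by
      intro q
      rw [he, Fin.prod_univ_succ]
      simp [MeasurableEquiv.piFinSuccAbove, Fin.insertNthEquiv]
    simp_rw [hX, ← mul_assoc]
    rw [(padic_summable_mul hae' (fun q => hone n (fun j => φ (Fin.succAbove 0 j))
      (fun j => hφ _) x' q.1)).tsum_prod]
    exact tsum_congr fun t => by rw [← tsum_mul_right]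

/-- Let `f(x₁, …, xₙ) = Σ_s a_s x^s` be a multivariable power series with coefficients in
`ℚ_p`, not all zero, which converges at every point of an open subset `D ⊆ ℤ_pⁿ`.  Then the
zero set of `f` in `D` has measure zero with respect to Haar measure on `ℤ_pⁿ`. -/
theorem zero_set_of_padic_power_series_measure_zero (p : ℕ) [Fact p.Prime] (n : ℕ)
    (hn : 0 < n) (a : (Fin n → ℕ) → ℚ_[p]) (ha : ∃ s, a s ≠ 0)
    (D : Set (Fin n → ℤ_[p])) (hD : IsOpen D)
    (hconv : ∀ x ∈ D, Summable fun s : Fin n → ℕ => a s * ∏ i, (x i : ℚ_[p]) ^ s i)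
    (μ : Measure (Fin n → ℤ_[p])) [μ.IsAddHaarMeasure] :
    μ {x | x ∈ D ∧ ∑' s : Fin n → ℕ, a s * ∏ i, (x i : ℚ_[p]) ^ s i = 0} = 0 := by
  let : MeasurableSpace ℚ_[p] := borel _
  have : BorelSpace ℚ_[p] := ⟨rfl⟩
  let ν : Measure ℤ_[p] := Measure.addHaar
  have hna : ∀ x, ν {x} = 0 := by
    have : (𝓝[≠] (0 : ℤ_[p])).NeBot := by
      rw [← mem_closure_iff_nhdsWithin_neBot, Metric.mem_closure_iff]
      intro ε hε
      obtain ⟨k, hk⟩ := PadicInt.exists_pow_neg_lt p hε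
      refine ⟨(p : ℤ_[p]) ^ k, ?_, ?_⟩
      · simp [(Fact.out : p.Prime).ne_zero]
      · rw [dist_comm, dist_zero_right, PadicInt.norm_p_pow]
        exact hk
    exact fun x => measure_singleton x
  have : NullSingletonClass ν := ⟨hna⟩
  let P : Measure (Fin n → ℤ_[p]) := Measure.pi fun _ => ν
  have hac : μ ≪ P := by
    rw [Measure.isAddLeftInvariant_eq_smul μ P]
    exact Measure.smul_absolutelyContinuous
  apply hac
  have hhyp : P (⋃ i : Fin n, {x | x i = 0}) = 0 := by
    refine measure_iUnion_null fun i => ?_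
    exact Measure.pi_hyperplane (μ := fun _ => ν) i 0
  set S : Set (Fin n → ℤ_[p]) :=
    {x | x ∈ D ∧ ∑' s : Fin n → ℕ, a s * ∏ i, (x i : ℚ_[p]) ^ s i = 0} with hS
  suffices h : P (S \ ⋃ i : Fin n, {x | x i = 0}) = 0 from
    measure_mono_null (fun x hx => by
      by_cases h : x ∈ ⋃ i : Fin n, {x : Fin n → ℤ_[p] | x i = 0}
      · exact Or.inr h
      · exact Or.inl ⟨hx, h⟩) (measure_union_null h hhyp)
  refine measure_null_of_locally_null _ fun c hc => ?_
  obtain ⟨⟨hcD, -⟩, hc0⟩ := hc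
  have hc0 : ∀ i, c i ≠ 0 := by simpa using hc0
  let B : Fin n → Set ℤ_[p] := fun i => Metric.closedBall 0 ‖c i‖
  have hBo : IsOpen (Set.univ.pi B) :=
    isOpen_set_pi Set.finite_univ fun i _ =>
      IsUltrametricDist.isOpen_closedBall _ (norm_ne_zero_iff.2 (hc0 i))
  have hcB : c ∈ Set.univ.pi B := fun i _ => by simp [B]
  refine ⟨(S \ ⋃ i : Fin n, {x | x i = 0}) ∩ Set.univ.pi B,
    Filter.inter_mem self_mem_nhdsWithin (mem_nhdsWithin_of_mem_nhds (hBo.mem_nhds hcB)), ?_⟩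
  have hBm : ∀ i, MeasurableSet (B i) := fun i => Metric.isClosed_closedBall.measurableSet
  classical
  let φ : Fin n → ℤ_[p] → ℚ_[p] := fun i => (B i).indicator fun x => (x : ℚ_[p]) / (c i : ℚ_[p])
  have hc0' : ∀ i, (c i : ℚ_[p]) ≠ 0 := fun i => by
    simpa using hc0 i
  have hφB : ∀ i, ∀ x ∈ B i, φ i x = (x : ℚ_[p]) / (c i : ℚ_[p]) := fun i x hx =>
    Set.indicator_of_mem hx _
  obtain ⟨s, hs⟩ := ha
  have key := padic_null_aux n (fun s => a s * ∏ i, (c i : ℚ_[p]) ^ s i) (hconv c hcD)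
    ⟨s, mul_ne_zero hs (Finset.prod_ne_zero_iff.2 fun i _ => pow_ne_zero _ (hc0' i))⟩
    (fun i => ν.restrict (B i)) φ
    (fun i => by
      refine Measurable.indicator ?_ (hBm i)
      have : Continuous fun x : ℤ_[p] => (x : ℚ_[p]) / (c i : ℚ_[p]) :=
        continuous_subtype_val.div_const _
      exact this.measurable)
    (fun i x => by
      by_cases hx : x ∈ B i
      · rw [hφB i x hx, norm_div]
        refine div_le_one_of_le₀ ?_ (norm_nonneg _)
        simpa [B] using hx
      · simp [φ, hx])
    (fun i y => by
      rw [Measure.restrict_apply' (hBm i)]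
      refine Set.Subsingleton.measure_zero ?_ ν
      rintro x ⟨hx, hxB⟩ z ⟨hz, hzB⟩
      have hx : φ i x = y := hx
      have hz : φ i z = y := hz
      rw [hφB i x hxB] at hx
      rw [hφB i z hzB, ← hx, div_left_inj' (hc0' i)] at hz
      exact (Subtype.ext hz).symm)
  rw [← Measure.restrict_pi_pi, Measure.restrict_apply' (MeasurableSet.univ_pi hBm)] at key
  refine measure_mono_null ?_ key
  rintro x ⟨⟨⟨-, hx⟩, -⟩, hxB⟩
  refine ⟨?_, hxB⟩
  rw [Set.mem_ofPred_eq, ← hx]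
  refine tsum_congr fun t => ?_
  rw [mul_assoc, ← Finset.prod_mul_distrib]
  congr 1
  refine Finset.prod_congr rfl fun i _ => ?_
  rw [hφB i _ (hxB i trivial), ← mul_pow, mul_div_cancel₀ _ (hc0' i)]
end
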